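/- Let T = T(B) be a d-level block Toeplitz matrix that is positive semidefinite and has rank r < min_i N_i. Then there exist r pairwise distinct points f_1, ..., f_r ∈ [0,1)^d and positive real numbers σ_1, ..., σ_r such that T = ∑_{ℓ=1}^{r} σ_ℓ a(f_ℓ) a(f_ℓ)ᴴ. -/

import Mathlib

open Complex Matrix BigOperators
open scoped ComplexOrder

/-- The multi-dimensional sinusoid `a(f) ∈ ℂ^I`, `a(f)(m) = ∏ i, exp(2πi m_i f_i)`. -/
noncomputable def sinusoid {d : ℕ} (N : Fin d → ℕ) (f : Fin d → ℝ) :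
    (∀ i, Fin (N i)) → ℂ :=
  fun m => ∏ i, Complex.exp (2 * (Real.pi : ℂ) * Complex.I * ((m i : ℕ) : ℂ) * ((f i : ℝ) : ℂ))

/-- The `d`-level block Toeplitz matrix `T(B)(m,n) = B(m-n)`. -/
noncomputable def toepT {d : ℕ} (N : Fin d → ℕ) (B : (Fin d → ℤ) → ℂ) :
    Matrix (∀ i, Fin (N i)) (∀ i, Fin (N i)) ℂ :=
  Matrix.of fun m n => B (fun i => (m i : ℤ) - (n i : ℤ))

section Isometry

variable {H : Type*} [NormedAddCommGroup H] [InnerProductSpace ℂ H]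

theorem LinearIsometry.maxGenEigenspace_eq_eigenspace (U : H →ₗᵢ[ℂ] H) (μ : ℂ) :
    Module.End.maxGenEigenspace U.toLinearMap μ = Module.End.eigenspace U.toLinearMap μ := by
  refine le_antisymm (fun x hx => ?_) Module.End.eigenspace_le_maxGenEigenspace
  have key : ∀ x : H, U (U x - μ • x) = μ • (U x - μ • x) → U x - μ • x = 0 := by
    intro x h
    set y := U x - μ • x with hy
    by_contra hy0
    have hUx : U x = μ • x + y := by rw [hy]; abel
    have hμ : ‖μ‖ = 1 := by
      have := U.norm_map y
      rw [h, norm_smul] at this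
      exact mul_right_cancel₀ (norm_ne_zero_iff.2 hy0) (by rw [this, one_mul])
    have hμ' : (starRingEnd ℂ) μ * μ = 1 := by
      rw [Complex.conj_mul', hμ]; simp
    have h1 := U.inner_map_map y x
    rw [h, hUx, inner_add_right, inner_smul_left, inner_smul_left, inner_smul_right, ← mul_assoc,
      hμ', one_mul, add_eq_left, mul_eq_zero] at h1
    rcases h1 with h1 | h1
    · rw [h1, zero_mul] at hμ'
      exact zero_ne_one hμ'
    · exact hy0 (inner_self_eq_zero.1 h1)
  obtain ⟨k, hk⟩ := (Module.End.mem_maxGenEigenspace _ _ _).1 hx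
  rw [Module.End.mem_eigenspace_iff]
  clear hx
  induction k generalizing x with
  | zero =>
    have : x = 0 := by simpa using hk
    simp [this]
  | succ k ih =>
    rw [pow_succ, Module.End.mul_apply] at hk
    have := ih _ hk
    simp only [LinearMap.sub_apply, LinearMap.smul_apply, Module.End.one_apply,
      LinearIsometry.coe_toLinearMap] at this
    exact sub_eq_zero.1 (key x this)

/-- Joint eigenvectors of isometries for distinct systems of eigenvalues are orthogonal. -/
theorem inner_eq_zero_of_joint_eigenvalue_ne {ι : Type*} {U : ι → H →ₗᵢ[ℂ] H} {χ ψ : ι → ℂ}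
    {x y : H} (hχ : ∀ i, ‖χ i‖ = 1)
    (hx : ∀ i, U i x = χ i • x) (hy : ∀ i, U i y = ψ i • y) (hne : χ ≠ ψ) :
    inner ℂ x y = 0 := by
  obtain ⟨i, hi⟩ := Function.ne_iff.1 hne
  have h := (U i).inner_map_map x y
  rw [hx, hy, inner_smul_left, inner_smul_right] at h
  by_contra h0
  have h1 : (starRingEnd ℂ) (χ i) * ψ i = 1 :=
    mul_right_cancel₀ h0 (by rw [one_mul, mul_assoc]; exact h)
  have h2 : χ i * (starRingEnd ℂ) (χ i) = 1 := by
    rw [Complex.mul_conj', hχ]; simp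
  apply hi
  calc χ i = χ i * ((starRingEnd ℂ) (χ i) * ψ i) := by rw [h1, mul_one]
    _ = ψ i := by rw [← mul_assoc, h2, one_mul]

variable [FiniteDimensional ℂ H]

/-- Two families of vectors with the same Gram matrix are related by a linear isometry. -/
theorem exists_linearIsometry_of_inner_eq {J : Type*} (x y : J → H)
    (hxy : ∀ a b, inner ℂ (x a) (x b) = inner ℂ (y a) (y b)) :
    ∃ U : H →ₗᵢ[ℂ] H, ∀ a, U (x a) = y a := by
  have hnorm : ∀ c : J →₀ ℂ,
      ‖Finsupp.linearCombination ℂ x c‖ = ‖Finsupp.linearCombination ℂ y c‖ := by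
    intro c
    have : inner ℂ (Finsupp.linearCombination ℂ x c) (Finsupp.linearCombination ℂ x c) =
        inner ℂ (Finsupp.linearCombination ℂ y c) (Finsupp.linearCombination ℂ y c) := by
      simp only [Finsupp.linearCombination_apply, Finsupp.sum, sum_inner, inner_sum,
        inner_smul_left, inner_smul_right, hxy]
    rw [inner_self_eq_norm_sq_to_K, inner_self_eq_norm_sq_to_K] at this
    exact (sq_eq_sq₀ (norm_nonneg _) (norm_nonneg _)).1 (by exact_mod_cast this)
  obtain ⟨g, hg⟩ := (Finsupp.linearCombination ℂ x).rangeRestrict.exists_rightInverse_of_surjective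
    (LinearMap.range_rangeRestrict _)
  have hg' : ∀ s, Finsupp.linearCombination ℂ x (g s) = s := fun s =>
    congrArg Subtype.val (LinearMap.congr_fun hg s)
  let L : LinearMap.range (Finsupp.linearCombination ℂ x) →ₗᵢ[ℂ] H :=
    { toLinearMap := Finsupp.linearCombination ℂ y ∘ₗ g
      norm_map' := fun s => by
        rw [LinearMap.comp_apply, ← hnorm, hg', Submodule.coe_norm] }
  refine ⟨L.extend, fun a => ?_⟩
  have ha : x a = Finsupp.linearCombination ℂ x (Finsupp.single a 1) := by simp
  have hmem : x a ∈ LinearMap.range (Finsupp.linearCombination ℂ x) := ⟨_, ha.symm⟩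
  refine (L.extend_apply ⟨x a, hmem⟩).trans ?_
  change Finsupp.linearCombination ℂ y (g ⟨x a, hmem⟩) = y a
  have h0 := hnorm (g ⟨x a, hmem⟩ - Finsupp.single a 1)
  rw [map_sub, map_sub, hg', ← ha, sub_self, norm_zero, eq_comm, norm_eq_zero, sub_eq_zero] at h0
  simpa using h0

theorem LinearIsometry.iSup_iInf_eigenspace_eq_top {ι : Type*} (U : ι → H →ₗᵢ[ℂ] H)
    (h : ∀ i j, Commute (U i).toLinearMap (U j).toLinearMap) :
    ⨆ χ : ι → ℂ, ⨅ i, Module.End.eigenspace (U i).toLinearMap (χ i) = ⊤ := by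
  simp_rw [← LinearIsometry.maxGenEigenspace_eq_eigenspace]
  exact Module.End.iSup_iInf_maxGenEigenspace_eq_top_of_iSup_maxGenEigenspace_eq_top_of_commute
    (fun i => (U i).toLinearMap) (fun i j _ => h i j)
    fun i => Module.End.iSup_maxGenEigenspace_eq_top _

/-- A power of `U` of exponent at least the dimension is reducible to lower powers. -/
theorem pow_apply_mem_span_of_finrank_le (U : Module.End ℂ H) {n : ℕ}
    (hn : Module.finrank ℂ H < n + 1) (x : H) :
    (U ^ n) x ∈ Submodule.span ℂ {y | ∃ k < n, y = (U ^ k) x} := by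
  rcases Nat.eq_zero_or_pos n with rfl | hpos
  · have := Module.finrank_zero_iff.1 (show Module.finrank ℂ H = 0 by omega)
    rw [Subsingleton.elim ((U ^ 0) x) 0]
    exact zero_mem _
  have h1 : U ^ n = Polynomial.aeval U ((Polynomial.X : Polynomial ℂ) ^ n %ₘ U.charpoly) := by
    rw [← LinearMap.aeval_eq_aeval_mod_charpoly, map_pow, Polynomial.aeval_X]
  have hdeg : ((Polynomial.X : Polynomial ℂ) ^ n %ₘ U.charpoly).natDegree < n := by
    by_cases h1 : U.charpoly = 1
    · simpa [h1] using hpos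
    have := Polynomial.natDegree_modByMonic_lt (Polynomial.X ^ n) U.charpoly_monic h1
    rw [U.charpoly_natDegree] at this
    omega
  rw [h1, Polynomial.aeval_eq_sum_range' hdeg, LinearMap.sum_apply]
  refine Submodule.sum_mem _ fun k hk => ?_
  rw [LinearMap.smul_apply]
  exact Submodule.smul_mem _ _ (Submodule.subset_span ⟨k, Finset.mem_range.1 hk, rfl⟩)

end Isometry

section Grid

variable {H : Type*} [NormedAddCommGroup H] [InnerProductSpace ℂ H]
  {d : ℕ} {N : Fin d → ℕ} {w : (Fin d → ℕ) → H}

/-- `U i` sends `w n` to `w (n + e i)` whenever both indices lie in the box. -/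
def IsShift (N : Fin d → ℕ) (w : (Fin d → ℕ) → H) (U : Fin d → H →ₗᵢ[ℂ] H) : Prop :=
  ∀ i n, (∀ j, (n + Pi.single i 1 : Fin d → ℕ) j < N j) →
    U i (w n) = w (n + Pi.single i 1)

theorem lt_of_add_single_lt {n : Fin d → ℕ} {i : Fin d} {k : ℕ}
    (h : ∀ j, (n + Pi.single i k : Fin d → ℕ) j < N j) (j : Fin d) : n j < N j :=
  (Nat.le_add_right _ _).trans_lt (h j)

theorem IsShift.pow_apply {U : Fin d → H →ₗᵢ[ℂ] H} (hU : IsShift N w U) (i : Fin d)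
    (n : Fin d → ℕ) (k : ℕ) (hn : ∀ j, (n + Pi.single i k : Fin d → ℕ) j < N j) :
    ((U i).toLinearMap ^ k) (w n) = w (n + Pi.single i k) := by
  induction k with
  | zero => simp
  | succ k ih =>
    have e : n + Pi.single i (k + 1) = n + Pi.single i k + Pi.single i 1 := by
      rw [add_assoc, ← Pi.single_add]
    rw [e] at hn ⊢
    rw [pow_succ', Module.End.mul_apply, ih (lt_of_add_single_lt hn)]
    exact hU i _ hn

theorem IsShift.apply_eq_sum {U : Fin d → H →ₗᵢ[ℂ] H} (hU : IsShift N w U)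
    (p : (Fin d → ℂ) →₀ H)
    (hp : ∀ χ i, U i (p χ) = χ i • p χ) (h0 : w 0 = ∑ χ ∈ p.support, p χ)
    (n : Fin d → ℕ) (hn : ∀ i, n i < N i) :
    w n = ∑ χ ∈ p.support, (∏ i, χ i ^ n i) • p χ := by
  induction hs : ∑ i, n i generalizing n with
  | zero =>
    have : n = 0 := by
      ext i
      exact (Finset.sum_eq_zero_iff.1 hs) i (Finset.mem_univ i)
    subst this
    simpa using h0
  | succ s ih =>
    obtain ⟨i, -, hi⟩ := Finset.exists_ne_zero_of_sum_ne_zero (hs.trans_ne s.succ_ne_zero)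
    obtain ⟨m, rfl⟩ : ∃ m : Fin d → ℕ, n = m + Pi.single i 1 := by
      refine ⟨n - Pi.single i 1, ?_⟩
      ext j
      rcases eq_or_ne j i with rfl | hj
      · simp; omega
      · simp [hj]
    have hsm : ∑ i, m i = s := by
      simpa [Finset.sum_add_distrib] using hs
    rw [← hU i m hn, ih m (lt_of_add_single_lt hn) hsm, map_sum]
    refine Finset.sum_congr rfl fun χ _ => ?_
    rw [map_smul, hp, smul_smul]
    congr 1
    simp only [Pi.add_apply, pow_add, Finset.prod_mul_distrib]
    congr 1
    rw [Finset.prod_eq_single i] <;> simp +contextual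

variable [FiniteDimensional ℂ H]

theorem exists_isShift (B : (Fin d → ℤ) → ℂ)
    (hB : ∀ n m : Fin d → ℕ, (∀ i, n i < N i) → (∀ i, m i < N i) →
      inner ℂ (w n) (w m) = B fun i => (n i : ℤ) - m i) :
    ∃ U : Fin d → H →ₗᵢ[ℂ] H, IsShift N w U := by
  have : ∀ i, ∃ U : H →ₗᵢ[ℂ] H, ∀ a : {n : Fin d → ℕ // ∀ j, (n + Pi.single i 1 : Fin d → ℕ) j < N j},
      U (w a.1) = w (a.1 + Pi.single i 1) := by
    intro i
    refine exists_linearIsometry_of_inner_eq (J := {n : Fin d → ℕ // ∀ j, (n + Pi.single i 1 : Fin d → ℕ) j < N j})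
      (fun a => w a.1) (fun a => w (a.1 + Pi.single i 1)) fun a b => ?_
    rw [hB _ _ (lt_of_add_single_lt a.2) (lt_of_add_single_lt b.2), hB _ _ a.2 b.2]
    congr 1
    ext j
    simp
  choose U hU using this
  exact ⟨U, fun i n hn => hU i ⟨n, hn⟩⟩

theorem IsShift.mem_span {U : Fin d → H →ₗᵢ[ℂ] H} (hU : IsShift N w U) (i : Fin d)
    (hr : Module.finrank ℂ H < N i) (n : Fin d → ℕ) (hn : ∀ j, n j < N j) :
    w n ∈ Submodule.span ℂ
      {y | ∃ m : Fin d → ℕ, m i + 1 < N i ∧ (∀ j ≠ i, m j = n j) ∧ y = w m} := by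
  rcases Nat.lt_or_ge (n i + 1) (N i) with h | h
  · exact Submodule.subset_span ⟨n, h, fun _ _ => rfl, rfl⟩
  have hni : N i = n i + 1 := le_antisymm h (hn i)
  have e : ∀ k ≤ n i, ∀ j, (Function.update n i 0 + Pi.single i k : Fin d → ℕ) j < N j := by
    intro k hk j
    rcases eq_or_ne j i with rfl | hj
    · simpa using hk.trans_lt (hn j)
    · simpa [hj] using hn j
  have e2 : (Function.update n i 0 + Pi.single i (n i) : Fin d → ℕ) = n := by
    ext j
    rcases eq_or_ne j i with rfl | hj <;> simp [*]
  have h1 := hU.pow_apply i _ _ (e (n i) le_rfl)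
  rw [e2] at h1
  rw [← h1]
  refine Submodule.span_mono ?_ (pow_apply_mem_span_of_finrank_le _ (hni ▸ hr) _)
  rintro _ ⟨k, hk, rfl⟩
  refine ⟨Function.update n i 0 + Pi.single i k, ?_, fun j hj => by simp [hj],
    hU.pow_apply i _ _ (e k hk.le)⟩
  simp only [Pi.add_apply, Function.update_self, Pi.single_eq_same]
  omega

theorem IsShift.commute {U : Fin d → H →ₗᵢ[ℂ] H} (hU : IsShift N w U)
    (hr : ∀ i, Module.finrank ℂ H < N i)
    (hspan : Submodule.span ℂ (w '' {n | ∀ i, n i < N i}) = ⊤) (i j : Fin d) :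
    Commute (U i).toLinearMap (U j).toLinearMap := by
  rcases eq_or_ne i j with rfl | hij
  · exact Commute.refl _
  suffices h : (⊤ : Submodule ℂ H) ≤ LinearMap.eqLocus
      ((U i).toLinearMap * (U j).toLinearMap) ((U j).toLinearMap * (U i).toLinearMap) from
    LinearMap.ext fun x => h (Submodule.mem_top (x := x))
  rw [← hspan, Submodule.span_le]
  rintro _ ⟨n, hn, rfl⟩
  refine Submodule.span_le.2 ?_ (hU.mem_span i (hr i) n hn)
  rintro _ ⟨m, hmi, hm, rfl⟩
  have hmN : ∀ k, m k < N k := fun k => by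
    rcases eq_or_ne k i with rfl | hk
    · omega
    · rw [hm k hk]; exact hn k
  refine Submodule.span_le.2 ?_ (hU.mem_span j (hr j) m hmN)
  rintro _ ⟨l, hlj, hl, rfl⟩
  have hli : l i + 1 < N i := by rw [hl i hij]; exact hmi
  have hlN : ∀ k, l k < N k := fun k => by
    rcases eq_or_ne k j with rfl | hk
    · omega
    · rw [hl k hk]; exact hmN k
  have hb : ∀ k, (l + Pi.single i 1 + Pi.single j 1 : Fin d → ℕ) k < N k := fun k => by
    rcases eq_or_ne k i with rfl | hk
    · simpa [hij] using hli
    · rcases eq_or_ne k j with rfl | hk'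
      · simpa [hk] using hlj
      · simpa [hk, hk'] using hlN k
  have hb' : ∀ k, (l + Pi.single j 1 + Pi.single i 1 : Fin d → ℕ) k < N k := by
    rwa [add_right_comm]
  change U i (U j (w l)) = U j (U i (w l))
  rw [hU j l (lt_of_add_single_lt hb'), hU i l (lt_of_add_single_lt hb), hU i _ hb', hU j _ hb,
    add_right_comm]

theorem exists_spectral_decomposition (B : (Fin d → ℤ) → ℂ)
    (hB : ∀ n m : Fin d → ℕ, (∀ i, n i < N i) → (∀ i, m i < N i) →
      inner ℂ (w n) (w m) = B fun i => (n i : ℤ) - m i)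
    (hr : ∀ i, Module.finrank ℂ H < N i)
    (hspan : Submodule.span ℂ (w '' {n | ∀ i, n i < N i}) = ⊤) :
    ∃ p : (Fin d → ℂ) →₀ H, p.support.card = Module.finrank ℂ H ∧
      (∀ χ ∈ p.support, ∀ i, ‖χ i‖ = 1) ∧
      ∀ n m : Fin d → ℕ, (∀ i, n i < N i) → (∀ i, m i < N i) →
        (B fun i => (n i : ℤ) - m i) = ∑ χ ∈ p.support, ((‖p χ‖ ^ 2 : ℝ) : ℂ) *
          ((∏ i, (starRingEnd ℂ) (χ i) ^ n i) * ∏ i, χ i ^ m i) := by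
  obtain ⟨U, hU⟩ := exists_isShift B hB
  have htop := LinearIsometry.iSup_iInf_eigenspace_eq_top U (hU.commute hr hspan)
  obtain ⟨p, hp, h0⟩ := (Submodule.mem_iSup_iff_exists_finsupp _ (w 0)).1
    (htop ▸ Submodule.mem_top)
  have hp' : ∀ χ i, U i (p χ) = χ i • p χ := fun χ i =>
    Module.End.mem_eigenspace_iff.1 ((Submodule.mem_iInf _).1 (hp χ) i)
  have hnorm : ∀ χ ∈ p.support, ∀ i, ‖χ i‖ = 1 := fun χ hχ i => by
    have h := (U i).norm_map (p χ)
    rw [hp', norm_smul] at h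
    exact mul_right_cancel₀ (norm_ne_zero_iff.2 (Finsupp.mem_support_iff.1 hχ))
      (h.trans (one_mul _).symm)
  have hw := hU.apply_eq_sum p hp' h0.symm
  have horth : ∀ χ ∈ p.support, ∀ ψ, χ ≠ ψ → inner ℂ (p χ) (p ψ) = 0 := fun χ hχ ψ hne =>
    inner_eq_zero_of_joint_eigenvalue_ne (hnorm χ hχ) (hp' χ) (hp' ψ) hne
  refine ⟨p, ?_, hnorm, fun n m hn hm => ?_⟩
  · have hli : LinearIndependent ℂ fun χ : p.support => p χ :=
      linearIndependent_of_ne_zero_of_inner_eq_zero (fun χ => Finsupp.mem_support_iff.1 χ.2)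
        fun χ ψ hne => horth χ χ.2 ψ fun h => hne (Subtype.ext h)
    have hsp : ⊤ ≤ Submodule.span ℂ (Set.range fun χ : p.support => p χ) := by
      rw [← hspan, Submodule.span_le]
      rintro _ ⟨n, hn, rfl⟩
      rw [hw n hn]
      exact Submodule.sum_mem _ fun χ hχ =>
        Submodule.smul_mem _ _ (Submodule.subset_span ⟨⟨χ, hχ⟩, rfl⟩)
    simpa using (Module.finrank_eq_card_basis (Module.Basis.mk hli hsp)).symm
  · rw [← hB n m hn hm, hw n hn, hw m hm, sum_inner]
    refine Finset.sum_congr rfl fun χ hχ => ?_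
    rw [inner_sum, Finset.sum_eq_single_of_mem χ hχ]
    · rw [inner_smul_left, inner_smul_right, inner_self_eq_norm_sq_to_K, map_prod]
      simp only [map_pow]
      push_cast
      simp only [Complex.coe_algebraMap]
      ring
    · intro ψ _ hne
      rw [inner_smul_left, inner_smul_right, horth χ hχ ψ hne.symm, mul_zero, mul_zero]

end Grid

theorem exists_exp_eq_conj (z : ℂ) (hz : ‖z‖ = 1) :
    ∃ t ∈ Set.Ico (0 : ℝ) 1,
      Complex.exp (2 * (Real.pi : ℂ) * Complex.I * (t : ℂ)) = (starRingEnd ℂ) z := by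
  refine ⟨Int.fract (-z.arg / (2 * Real.pi)), ⟨Int.fract_nonneg _, Int.fract_lt_one _⟩, ?_⟩
  have hpi : (Real.pi : ℂ) ≠ 0 := by exact_mod_cast Real.pi_ne_zero
  have e : 2 * (Real.pi : ℂ) * Complex.I * (Int.fract (-z.arg / (2 * Real.pi)) : ℝ) =
      (starRingEnd ℂ) (z.arg * Complex.I) -
        ⌊-z.arg / (2 * Real.pi)⌋ * (2 * Real.pi * Complex.I) := by
    rw [Int.fract, map_mul, Complex.conj_ofReal, Complex.conj_I]
    push_cast
    field_simp
  have hexp : Complex.exp (z.arg * Complex.I) = z := by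
    simpa [hz] using Complex.norm_mul_exp_arg_mul_I z
  rw [e, Complex.exp_sub, Complex.exp_int_mul_two_pi_mul_I, div_one, Complex.exp_conj, hexp]

open scoped MatrixOrder Matrix.Norms.L2Operator in
theorem Matrix.PosSemidef.exists_eq_conjTranspose_mul_self {ι : Type*} [Fintype ι] [DecidableEq ι]
    {A : Matrix ι ι ℂ} (hA : A.PosSemidef) : ∃ C : Matrix ι ι ℂ, A = Cᴴ * C :=
  CStarAlgebra.nonneg_iff_eq_star_mul_self.1 hA.nonneg

/-- MD Vandermonde decomposition: a PSD `d`-level block Toeplitz matrix of rank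
`r < min_i N_i` decomposes as `∑ σ_ℓ a(f_ℓ) a(f_ℓ)ᴴ` with distinct `f_ℓ ∈ [0,1)^d`
and positive `σ_ℓ`. -/
theorem stmt0 {d : ℕ} (hd : 1 ≤ d) (N : Fin d → ℕ) (hN : ∀ i, 2 ≤ N i)
    (B : (Fin d → ℤ) → ℂ)
    (hpsd : (toepT N B).PosSemidef)
    (hrank : ∀ i, (toepT N B).rank < N i) :
    ∃ (f : Fin (toepT N B).rank → (Fin d → ℝ)) (σ : Fin (toepT N B).rank → ℝ),
      Function.Injective f ∧
      (∀ ℓ i, f ℓ i ∈ Set.Ico (0 : ℝ) 1) ∧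
      (∀ ℓ, 0 < σ ℓ) ∧
      toepT N B = ∑ ℓ, (σ ℓ : ℂ) •
        Matrix.vecMulVec (sinusoid N (f ℓ)) (star (sinusoid N (f ℓ))) := by
  obtain ⟨C, hC⟩ : ∃ C : Matrix (∀ i, Fin (N i)) (∀ i, Fin (N i)) ℂ, toepT N B = Cᴴ * C :=
    hpsd.exists_eq_conjTranspose_mul_self
  let c : (∀ i, Fin (N i)) → EuclideanSpace ℂ (∀ i, Fin (N i)) := fun m => WithLp.toLp 2 (C.col m)
  let S : Submodule ℂ (EuclideanSpace ℂ (∀ i, Fin (N i))) := Submodule.span ℂ (Set.range c)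
  have hS : Module.finrank ℂ S = (toepT N B).rank := by
    rw [hC, Matrix.rank_conjTranspose_mul_self, Matrix.rank_eq_finrank_span_cols,
      ← LinearEquiv.finrank_map_eq (WithLp.linearEquiv 2 ℂ ((∀ i, Fin (N i)) → ℂ)).symm,
      Submodule.map_span, ← Set.range_comp]
    rfl
  have hcinner : ∀ m n, inner ℂ (c m) (c n) = toepT N B m n := by
    intro m n
    rw [hC, EuclideanSpace.inner_eq_star_dotProduct, Matrix.mul_apply, dotProduct]
    exact Finset.sum_congr rfl fun k _ => mul_comm _ _
  let v : (∀ i, Fin (N i)) → S := fun m => ⟨c m, Submodule.subset_span ⟨m, rfl⟩⟩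
  have hv : Submodule.span ℂ (Set.range v) = ⊤ := by
    have := Submodule.span_span_coe_preimage (R := ℂ) (s := Set.range c)
    rw [← this]
    congr 1
    ext x
    simp [v, Subtype.ext_iff]
  have hpos : ∀ i, NeZero (N i) := fun i => ⟨by have := hN i; omega⟩
  let w : (Fin d → ℕ) → S := fun n => v fun i => Fin.ofNat (N i) (n i)
  have hw : ∀ m : ∀ i, Fin (N i), w (fun i => m i) = v m := fun m => by
    simp [w]
  obtain ⟨p, hcard, hnorm, hdec⟩ := exists_spectral_decomposition (N := N) (w := w) B
    (fun n m hn hm => by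
      change inner ℂ (c _) (c _) = _
      rw [hcinner]
      simp [toepT, Nat.mod_eq_of_lt, hn, hm])
    (fun i => hS ▸ hrank i)
    (by
      rw [eq_top_iff, ← hv]
      refine Submodule.span_mono ?_
      rintro _ ⟨m, rfl⟩
      exact ⟨fun i => m i, fun i => (m i).2, hw m⟩)
  rw [hS] at hcard
  let e : Fin (toepT N B).rank ≃ p.support := (finCongr hcard.symm).trans p.support.equivFin.symm
  choose t ht hexp using fun (χ : p.support) (i : Fin d) => exists_exp_eq_conj _ (hnorm χ χ.2 i)
  refine ⟨fun ℓ => t (e ℓ), fun ℓ => ‖p (e ℓ)‖ ^ 2, ?_, fun ℓ i => ht _ _, fun ℓ => ?_, ?_⟩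
  · intro a b hab
    apply e.injective
    ext i
    refine (starRingEnd ℂ).injective ?_
    rw [← hexp, ← hexp, show t (e a) i = t (e b) i from congrFun hab i]
  · exact pow_pos (norm_pos_iff.2 (Finsupp.mem_support_iff.1 (e ℓ).2)) 2
  · have hsin : ∀ (χ : p.support) (m : ∀ i, Fin (N i)),
        sinusoid N (t χ) m = ∏ i, (starRingEnd ℂ) (χ.1 i) ^ (m i : ℕ) := fun χ m => by
      refine Finset.prod_congr rfl fun i _ => ?_
      rw [← hexp, ← Complex.exp_nat_mul]
      congr 1
      ring
    ext m n
    have h := hdec (fun i => m i) (fun i => n i) (fun i => (m i).2) (fun i => (n i).2)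
    refine h.trans ?_
    rw [← Finset.sum_coe_sort, Matrix.sum_apply, ← e.sum_comp]
    refine Finset.sum_congr rfl fun ℓ _ => ?_
    rw [Matrix.smul_apply, Matrix.vecMulVec_apply, Pi.star_apply, hsin, hsin, smul_eq_mul,
      ← starRingEnd_apply, map_prod]
    simp only [map_pow, Complex.conj_conj]
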